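/- arXiv:1506.03720 — 8 statements merged into one kernel-verified Lean document; each statement's English description precedes it below -/
import Mathlib

section
/- For every s ∈ (0,1), every real K > 1, and all real numbers x, y > 0 with |x − y| ≤ x/K, one has |x^s − y^s| ≤ (s/(K−1)^{1−s}) · |x − y|^s. -/
open Real

/-- Increment bound for the concave function `x ↦ x ^ s` at a point `m` that dominates `c * d`. -/
theorem rpow_add_sub_rpow_le {s c m d : ℝ} (hs0 : 0 ≤ s) (hs1 : s ≤ 1) (hc : 0 < c)
    (hm : 0 < m) (hd : 0 ≤ d) (h : c * d ≤ m) :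
    (m + d) ^ s - m ^ s ≤ s / c ^ (1 - s) * d ^ s := by
  have hdm : 0 ≤ d / m := by positivity
  have bernoulli : (1 + d / m) ^ s ≤ 1 + s * (d / m) :=
    rpow_one_add_le_one_add_mul_self (by linarith) hs0 hs1
  have factor : (m + d) ^ s = m ^ s * (1 + d / m) ^ s := by
    rw [← mul_rpow hm.le (by positivity)]
    congr 1
    field_simp
  have split {a : ℝ} (ha : 0 ≤ a) : a ^ s * a ^ (1 - s) = a := by
    rw [← rpow_add_of_nonneg ha hs0 (by linarith), add_sub_cancel, rpow_one]
  have hpow : c ^ (1 - s) * d ^ (1 - s) ≤ m ^ (1 - s) := by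
    rw [← mul_rpow hc.le hd]
    exact rpow_le_rpow (by positivity) h (by linarith)
  have key : m ^ s * d * c ^ (1 - s) ≤ d ^ s * m :=
    calc m ^ s * d * c ^ (1 - s)
        = m ^ s * d ^ s * (c ^ (1 - s) * d ^ (1 - s)) := by
          nth_rewrite 1 [← split hd]
          ring
      _ ≤ m ^ s * d ^ s * m ^ (1 - s) := by gcongr
      _ = d ^ s * m := by
          nth_rewrite 3 [← split hm.le]
          ring
  calc (m + d) ^ s - m ^ s ≤ m ^ s * (1 + s * (d / m)) - m ^ s := by
        rw [factor]
        gcongr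
    _ = s * (m ^ s * d / m) := by ring
    _ ≤ s * (d ^ s / c ^ (1 - s)) := by
        gcongr s * ?_
        rwa [div_le_div_iff₀ hm (by positivity)]
    _ = s / c ^ (1 - s) * d ^ s := by ring

/-- For `s ∈ (0,1)`, `K > 1`, and `x, y > 0` with `|x − y| ≤ x/K`:
`|x^s − y^s| ≤ (s/(K−1)^{1−s})·|x−y|^s`. -/
theorem rpow_diff_le_of_close (s : ℝ) (hs : s ∈ Set.Ioo (0 : ℝ) 1) (K : ℝ) (hK : 1 < K)
    (x y : ℝ) (hx : 0 < x) (hy : 0 < y) (hxy : |x - y| ≤ x / K) :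
    |x ^ s - y ^ s| ≤ s / (K - 1) ^ (1 - s) * |x - y| ^ s := by
  obtain ⟨hs0, hs1⟩ := hs
  rw [le_div_iff₀ (by linarith)] at hxy
  rcases le_total x y with hle | hle
  · rw [abs_sub_comm x y, abs_of_nonneg (sub_nonneg.2 hle)] at *
    rw [abs_sub_comm, abs_of_nonneg (sub_nonneg.2 (rpow_le_rpow hx.le hle hs0.le))]
    have bound := rpow_add_sub_rpow_le hs0.le hs1.le (sub_pos.2 hK) hx (sub_nonneg.2 hle)
      (by linarith)
    rwa [add_sub_cancel] at bound
  · rw [abs_of_nonneg (sub_nonneg.2 hle)] at *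
    rw [abs_of_nonneg (sub_nonneg.2 (rpow_le_rpow hy.le hle hs0.le))]
    have bound := rpow_add_sub_rpow_le hs0.le hs1.le (sub_pos.2 hK) hy (sub_nonneg.2 hle)
      (by linarith)
    rwa [add_sub_cancel] at bound
end

section
/- For every s ∈ (0,1) and all real numbers x, y > 0, one has (x + y)^s ≤ (max(x,y)/(x+y))^{1−s} · (x^s + y^s). Consequently, if in addition K ≥ 1 and (1/K)·y ≤ x ≤ K·y, then (x + y)^s ≤ (K/(1+K))^{1−s} · (x^s + y^s). -/
open Real

/-- If `M` bounds `x, y > 0` and `s ≤ 1`, then `x + y ≤ M^{1-s}·(x^s + y^s)`. -/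
theorem add_le_rpow_mul_rpow_add_rpow {s x y M : ℝ} (hs : s ≤ 1) (hx : 0 < x) (hy : 0 < y)
    (hxM : x ≤ M) (hyM : y ≤ M) : x + y ≤ M ^ (1 - s) * (x ^ s + y ^ s) := by
  have key : ∀ z : ℝ, 0 < z → z ≤ M → z ≤ M ^ (1 - s) * z ^ s := fun z hz hzM => by
    calc z = z ^ (1 - s) * z ^ s := by rw [← rpow_add hz, sub_add_cancel, rpow_one]
      _ ≤ M ^ (1 - s) * z ^ s := by
        have := rpow_le_rpow hz.le hzM (sub_nonneg.2 hs)
        gcongr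
  rw [mul_add]
  exact add_le_add (key x hx hxM) (key y hy hyM)

/-- For `s ∈ (0,1)` and `x, y > 0`:
`(x+y)^s ≤ (max(x,y)/(x+y))^{1−s}·(x^s + y^s)`, and consequently if `K ≥ 1` and
`y/K ≤ x ≤ K·y` then `(x+y)^s ≤ (K/(1+K))^{1−s}·(x^s + y^s)`. -/
theorem rpow_add_le (s : ℝ) (hs : s ∈ Set.Ioo (0 : ℝ) 1) (x y : ℝ)
    (hx : 0 < x) (hy : 0 < y) :
    (x + y) ^ s ≤ (max x y / (x + y)) ^ (1 - s) * (x ^ s + y ^ s) ∧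
    ∀ K : ℝ, 1 ≤ K → y / K ≤ x → x ≤ K * y →
      (x + y) ^ s ≤ (K / (1 + K)) ^ (1 - s) * (x ^ s + y ^ s) := by
  have hxy : 0 < x + y := add_pos hx hy
  have hs1 : 0 ≤ 1 - s := sub_nonneg.2 hs.2.le
  have hmax : 0 < max x y := lt_max_of_lt_left hx
  have main : (x + y) ^ s ≤ (max x y / (x + y)) ^ (1 - s) * (x ^ s + y ^ s) := by
    rw [div_rpow hmax.le hxy.le, div_mul_eq_mul_div, le_div_iff₀ (rpow_pos_of_pos hxy _),
      ← rpow_add hxy, add_sub_cancel, rpow_one]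
    exact add_le_rpow_mul_rpow_add_rpow hs.2.le hx hy (le_max_left x y) (le_max_right x y)
  refine ⟨main, fun K hK hyx hxK => main.trans ?_⟩
  have hK0 : 0 < K := zero_lt_one.trans_le hK
  have hratio : max x y / (x + y) ≤ K / (1 + K) := by
    rw [div_le_iff₀ hK0] at hyx
    rw [div_le_div_iff₀ hxy (by positivity)]
    rcases max_cases x y with ⟨h, -⟩ | ⟨h, -⟩ <;> rw [h] <;> linarith
  gcongr
end

section
/- There exists an absolute constant C (one may take C = 5) such that for every nonzero integer k, every integer l, and every real number η, the improper integral satisfies ∫₀^∞ |k|·⟨l⟩ / (k² + l² + (η − kt)²) dt ≤ C. -/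
open MeasureTheory

theorem integrable_inv_one_add_sq_comp_affine {c : ℝ} (hc : c ≠ 0) (d : ℝ) :
    Integrable fun t : ℝ => (1 + (c * t - d) ^ 2)⁻¹ :=
  (integrable_inv_one_add_sq.comp_sub_right d).comp_mul_left' hc

theorem integral_inv_one_add_sq_comp_affine (c d : ℝ) :
    ∫ t : ℝ, (1 + (c * t - d) ^ 2)⁻¹ = |c⁻¹| * Real.pi := by
  rw [Measure.integral_comp_mul_left (fun x : ℝ => (1 + (x - d) ^ 2)⁻¹) c,
    integral_sub_right_eq_self (fun x : ℝ => (1 + x ^ 2)⁻¹) d, integral_univ_inv_one_add_sq,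
    smul_eq_mul]

/-- Uniform-in-`(k,η,l)` time-integrability of the `w_L` multiplier symbol:
`∫₀^∞ |k|⟨l⟩/(k² + l² + (η − kt)²) dt ≤ 5` for every nonzero integer `k`,
where `⟨l⟩ = √(1 + l²)`. -/
theorem wL_symbol_time_integrable (k : ℤ) (hk : k ≠ 0) (l : ℤ) (η : ℝ) :
    ∫ t in Set.Ioi (0 : ℝ),
        (|(k : ℝ)| * Real.sqrt (1 + (l : ℝ) ^ 2)) /
          ((k : ℝ) ^ 2 + (l : ℝ) ^ 2 + (η - k * t) ^ 2) ≤ 5 := by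
  have hk' : (k : ℝ) ≠ 0 := Int.cast_ne_zero.mpr hk
  have hk_abs : 0 < |(k : ℝ)| := abs_pos.mpr hk'
  have hk_sq : (1 : ℝ) ≤ (k : ℝ) ^ 2 := by
    have h : 0 < k ^ 2 := by positivity
    exact_mod_cast h
  set A := Real.sqrt (1 + (l : ℝ) ^ 2)
  set B := Real.sqrt ((k : ℝ) ^ 2 + (l : ℝ) ^ 2)
  have hB_pos : 0 < B := Real.sqrt_pos.mpr (by positivity)
  have hB_sq : (k : ℝ) ^ 2 + (l : ℝ) ^ 2 = B ^ 2 := (Real.sq_sqrt (by positivity)).symm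
  have hAB : A ≤ B := Real.sqrt_le_sqrt (by linarith)
  have h_rescale (t : ℝ) : |(k : ℝ)| * A / ((k : ℝ) ^ 2 + (l : ℝ) ^ 2 + (η - k * t) ^ 2) =
      |(k : ℝ)| * A / B ^ 2 * (1 + (k / B * t - η / B) ^ 2)⁻¹ := by
    have h : B ^ 2 + (η - k * t) ^ 2 = B ^ 2 * (1 + (k / B * t - η / B) ^ 2) := by
      field_simp
      ring
    rw [hB_sq, h, div_mul_eq_div_div, div_eq_mul_inv _ (1 + _)]
  simp_rw [h_rescale]
  have h_int := (integrable_inv_one_add_sq_comp_affine (div_ne_zero hk' hB_pos.ne')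
    (η / B)).const_mul (|(k : ℝ)| * A / B ^ 2)
  calc _ ≤ ∫ t : ℝ, |(k : ℝ)| * A / B ^ 2 * (1 + (k / B * t - η / B) ^ 2)⁻¹ :=
        setIntegral_le_integral h_int (Filter.Eventually.of_forall fun t => by positivity)
    _ = A / B * Real.pi := by
        rw [integral_const_mul, integral_inv_one_add_sq_comp_affine, inv_div, abs_div,
          abs_of_pos hB_pos]
        field_simp
    _ ≤ 1 * Real.pi := by
        gcongr
        exact (div_le_one hB_pos).mpr hAB
    _ ≤ 5 := by linarith [Real.pi_le_four]
end

section
/- For every nonzero integer k, all integers l and l′, all real numbers η and ξ, and every real t ≥ 1, one has ⟨t/⟨ξ,l′⟩⟩ ≤ 2 · (|k| + |η − kt| + |l|) · (1 + |η − ξ| + |l − l′|). -/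
/-- Japanese bracket `⟨a⟩ = √(1 + a²)`. -/
noncomputable def jap (a : ℝ) : ℝ := Real.sqrt (1 + a ^ 2)

/-- Japanese bracket of a pair (ℓ¹ convention): `⟨a,b⟩ = √(1 + (|a| + |b|)²)`. -/
noncomputable def jap2 (a b : ℝ) : ℝ := Real.sqrt (1 + (|a| + |b|) ^ 2)

theorem jap_le_one_add {a : ℝ} (ha : 0 ≤ a) : jap a ≤ 1 + a :=
  (Real.sqrt_le_left (by positivity)).2 (by nlinarith)

theorem one_le_jap2 (a b : ℝ) : 1 ≤ jap2 a b :=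
  Real.one_le_sqrt.2 (by nlinarith [sq_nonneg (|a| + |b|)])

theorem abs_le_jap2_left (a b : ℝ) : |a| ≤ jap2 a b :=
  Real.le_sqrt_of_sq_le (by nlinarith [mul_nonneg (abs_nonneg a) (abs_nonneg b), sq_nonneg |b|])

/-- Absorbing long-time losses: for `k ≠ 0` and `t ≥ 1`,
`⟨t/⟨ξ,l′⟩⟩ ≤ 2(|k| + |η − kt| + |l|)(1 + |η − ξ| + |l − l′|)`. -/
theorem absorb_long_time_loss (k : ℤ) (hk : k ≠ 0) (l l' : ℤ) (η ξ : ℝ) (t : ℝ)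
    (ht : 1 ≤ t) :
    jap (t / jap2 ξ (l' : ℝ)) ≤
      2 * (|(k : ℝ)| + |η - k * t| + |(l : ℝ)|) * (1 + |η - ξ| + |(l : ℝ) - (l' : ℝ)|) := by
  have hk1 : (1 : ℝ) ≤ |(k : ℝ)| := by exact_mod_cast Int.one_le_abs hk
  have hJ := one_le_jap2 ξ l'
  have hξ := abs_le_jap2_left ξ l'
  set J := jap2 ξ (l' : ℝ)
  set A := |(k : ℝ)| + |η - k * t| + |(l : ℝ)| with hA
  set B := 1 + |η - ξ| + |(l : ℝ) - (l' : ℝ)| with hB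
  have hA1 : 1 + |η - k * t| ≤ A := by linarith [abs_nonneg (l : ℝ)]
  have hB1 : 1 + |η - ξ| ≤ B := by linarith [abs_nonneg ((l : ℝ) - l')]
  have hd := abs_nonneg (η - ξ)
  have he := abs_nonneg (η - k * t)
  have hAB : 1 + |η - k * t| + |η - ξ| ≤ A * B := by
    nlinarith [mul_nonneg he hd, mul_le_mul hA1 hB1 (by positivity) (by linarith)]
  have hkt : t ≤ |ξ| + |η - ξ| + |η - k * t| := calc
    t ≤ |(k : ℝ)| * t := le_mul_of_one_le_left (by linarith) hk1
    _ = |k * t| := by rw [abs_mul, abs_of_nonneg (by linarith : 0 ≤ t)]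
    _ = |ξ + (η - ξ) - (η - k * t)| := by ring_nf
    _ ≤ |ξ| + |η - ξ| + |η - k * t| :=
      (abs_sub _ _).trans (by gcongr; exact abs_add_le _ _)
  have htJ : t / J ≤ A * B := by
    rw [div_le_iff₀ (by linarith)]
    nlinarith
  have h0 : 0 ≤ t / J := div_nonneg (by linarith) (by linarith)
  linarith [jap_le_one_add h0]
end

section
/- There exists an absolute constant C such that for every nonzero integer k, all integers l and l′, and all real numbers η, ξ, and t, one has √(|k|·⟨l⟩) / (|k| + |l| + |η − kt|) ≤ C · √(|k|·⟨l′⟩) / (|k| + |l′| + |ξ − kt|) · ⟨η − ξ, l − l′⟩². -/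
theorem one_le_jap (a : ℝ) : 1 ≤ jap a :=
  Real.one_le_sqrt.2 (by nlinarith [sq_nonneg a])

theorem abs_le_jap (a : ℝ) : |a| ≤ jap a :=
  Real.abs_le_sqrt (by linarith)

theorem jap_le_jap_add_abs_sub (a b : ℝ) : jap a ≤ jap b + |a - b| := by
  have hb := one_le_jap b
  have hsq : jap b ^ 2 = 1 + b ^ 2 := Real.sq_sqrt (by positivity)
  have hmul : b * (a - b) ≤ jap b * |a - b| :=
    (le_abs_self _).trans ((abs_mul b (a - b)).trans_le
      (mul_le_mul_of_nonneg_right (abs_le_jap b) (abs_nonneg _)))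
  refine Real.sqrt_le_iff.2 ⟨by positivity, ?_⟩
  nlinarith [sq_abs (a - b)]

theorem jap2_sq (a b : ℝ) : jap2 a b ^ 2 = 1 + (|a| + |b|) ^ 2 :=
  Real.sq_sqrt (by positivity)

theorem sqrt_mul_jap_le {c d a b : ℝ} (hc : 0 ≤ c) (hd : |a - b| ≤ d) :
    Real.sqrt (c * jap a) ≤ Real.sqrt (c * jap b) * (1 + d) := by
  have hd0 : 0 ≤ d := (abs_nonneg _).trans hd
  have hb := one_le_jap b
  have hab : jap a ≤ jap b * (1 + d) ^ 2 := by
    have := jap_le_jap_add_abs_sub a b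
    nlinarith [mul_nonneg (sub_nonneg.2 hb) hd0, mul_nonneg (sub_nonneg.2 hb) (sq_nonneg d)]
  calc Real.sqrt (c * jap a) ≤ Real.sqrt (c * jap b * (1 + d) ^ 2) := by
        apply Real.sqrt_le_sqrt
        rw [mul_assoc]
        exact mul_le_mul_of_nonneg_left hab hc
    _ = Real.sqrt (c * jap b) * (1 + d) := by
        rw [Real.sqrt_mul (by positivity), Real.sqrt_sq (by positivity)]

/-- Comparison of the `√(∂_t w_L/w_L)` Cauchy–Kovalevskaya weight at two nearby
frequencies sharing the same `x`-frequency `k`: there is an absolute constant `C` with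
`√(|k|⟨l⟩)/(|k| + |l| + |η − kt|) ≤ C·√(|k|⟨l′⟩)/(|k| + |l′| + |ξ − kt|)·⟨η−ξ, l−l′⟩²`. -/
theorem CKwL_frequency_ratio :
    ∃ C : ℝ, 0 < C ∧
      ∀ (k : ℤ), k ≠ 0 → ∀ (l l' : ℤ) (η ξ t : ℝ),
        Real.sqrt (|(k : ℝ)| * jap (l : ℝ)) / (|(k : ℝ)| + |(l : ℝ)| + |η - k * t|) ≤
          C * (Real.sqrt (|(k : ℝ)| * jap (l' : ℝ)) /
                (|(k : ℝ)| + |(l' : ℝ)| + |ξ - k * t|)) *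
            jap2 (η - ξ) ((l : ℝ) - (l' : ℝ)) ^ 2 := by
  refine ⟨2, two_pos, fun k hk l l' η ξ t => ?_⟩
  have hk1 : (1 : ℝ) ≤ |(k : ℝ)| := by exact_mod_cast Int.one_le_abs hk
  rw [jap2_sq]
  set d : ℝ := |η - ξ| + |(l : ℝ) - l'| with hd
  have hd0 : 0 ≤ d := by positivity
  have hS := sqrt_mul_jap_le (abs_nonneg (k : ℝ))
    (le_add_of_nonneg_left (abs_nonneg (η - ξ)) : |(l : ℝ) - l'| ≤ d)
  set S := Real.sqrt (|(k : ℝ)| * jap (l' : ℝ))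
  have hS0 : 0 ≤ S := Real.sqrt_nonneg _
  set A := |(k : ℝ)| + |(l : ℝ)| + |η - k * t| with hA
  set B := |(k : ℝ)| + |(l' : ℝ)| + |ξ - k * t| with hB
  have hA1 : 1 ≤ A := by
    linarith [abs_nonneg (l : ℝ), abs_nonneg (η - k * t)]
  have hB0 : 0 < B := by positivity
  have hBA : B ≤ A * (1 + d) := by
    have hl := abs_sub_abs_le_abs_sub (l' : ℝ) l
    have hη := abs_sub_abs_le_abs_sub (ξ - k * t) (η - k * t)
    rw [abs_sub_comm] at hl
    rw [sub_sub_sub_cancel_right, abs_sub_comm ξ η] at hη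
    nlinarith [mul_nonneg (sub_nonneg.2 hA1) hd0]
  have hA0 : 0 < A := one_pos.trans_le hA1
  rw [mul_div_assoc', div_mul_eq_mul_div, div_le_div_iff₀ hA0 hB0]
  calc _ ≤ S * (1 + d) * (A * (1 + d)) := by gcongr
    _ = S * A * (1 + d) ^ 2 := by ring
    _ ≤ S * A * (2 * (1 + d ^ 2)) := by
        gcongr
        nlinarith [sq_nonneg (1 - d)]
    _ = 2 * S * (1 + d ^ 2) * A := by ring
end

section
/- For every real number p there exists a constant C = C(p) such that for every nonzero integer k, all integers l and l′, every real number ξ, and every real t ≥ 1, one has |l|³ / (k² + l′² + (ξ − kt)²) · ⟨t/⟨ξ,l′⟩⟩^p ≤ C · |l| · ( ⟨l − l′⟩² + (l² / ⟨ξ, l′, t⟩²) · ⟨t/⟨ξ,l′⟩⟩^p ). -/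
/-- Japanese bracket of a triple (ℓ¹ convention): `⟨a,b,c⟩ = √(1 + (|a| + |b| + |c|)²)`. -/
noncomputable def jap3 (a b c : ℝ) : ℝ := Real.sqrt (1 + (|a| + |b| + |c|) ^ 2)

theorem jap_sq (a : ℝ) : jap a ^ 2 = 1 + a ^ 2 := Real.sq_sqrt (by positivity)

theorem jap3_sq (a b c : ℝ) : jap3 a b c ^ 2 = 1 + (|a| + |b| + |c|) ^ 2 :=
  Real.sq_sqrt (by positivity)

theorem add_abs_le_jap2 (a b : ℝ) : |a| + |b| ≤ jap2 a b :=
  Real.le_sqrt_of_sq_le (by linarith)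

/-- The bracket is bounded on `[0, 2]`, and hence so are its real powers. -/
theorem jap_rpow_le {a : ℝ} (ha : 0 ≤ a) (ha2 : a ≤ 2) (p : ℝ) : jap a ^ p ≤ 3 ^ |p| := by
  have h1 := one_le_jap a
  have h3 : jap a ≤ 3 := by nlinarith [jap_sq a]
  calc jap a ^ p ≤ jap a ^ |p| := Real.rpow_le_rpow_of_exponent_le h1 (le_abs_self p)
    _ ≤ 3 ^ |p| := Real.rpow_le_rpow (by linarith) h3 (abs_nonneg p)

/-- For times beyond twice the frequency there is no resonance, and the symbol of the Laplacian
in the moving frame is comparable to `⟨ξ, m, t⟩²`. -/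
theorem jap3_sq_le_of_two_mul_jap2_le {κ m ξ t : ℝ} (hκ : 1 ≤ |κ|) (ht : 1 ≤ t)
    (h : 2 * jap2 ξ m ≤ t) : jap3 ξ m t ^ 2 ≤ 16 * (κ ^ 2 + m ^ 2 + (ξ - κ * t) ^ 2) := by
  have hs := add_abs_le_jap2 ξ m
  have hm := abs_nonneg m
  have hξ := abs_nonneg ξ
  have hfar : t / 2 ≤ |ξ - κ * t| := by
    have h1 : |κ * t| - |ξ| ≤ |ξ - κ * t| := by
      rw [abs_sub_comm]; exact abs_sub_abs_le_abs_sub _ _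
    rw [abs_mul, abs_of_nonneg (by linarith : 0 ≤ t)] at h1
    nlinarith
  have hsq : (t / 2) ^ 2 ≤ (ξ - κ * t) ^ 2 := by
    rw [← sq_abs (ξ - κ * t)]
    exact pow_le_pow_left₀ (by linarith) hfar 2
  rw [jap3_sq, abs_of_nonneg (by linarith : 0 ≤ t)]
  have : (|ξ| + |m| + t) ^ 2 ≤ (3 / 2 * t) ^ 2 :=
    pow_le_pow_left₀ (by linarith) (by linarith) 2
  nlinarith [sq_nonneg κ, sq_nonneg m]

theorem sq_div_le_jap_sub_sq {κ m y : ℝ} (hκ : 1 ≤ |κ|) (x : ℝ) :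
    x ^ 2 / (κ ^ 2 + m ^ 2 + y ^ 2) ≤ 2 * jap (x - m) ^ 2 := by
  have hκ2 : 1 ≤ κ ^ 2 := (one_le_sq_iff_one_le_abs κ).2 hκ
  rw [div_le_iff₀ (by positivity), jap_sq]
  calc x ^ 2 ≤ 2 * (1 + (x - m) ^ 2) * (1 + m ^ 2) := by
        nlinarith [sq_nonneg (x - 2 * m), mul_nonneg (sq_nonneg (x - m)) (sq_nonneg m)]
    _ ≤ _ := mul_le_mul_of_nonneg_left (by nlinarith [sq_nonneg y]) (by positivity)

/-- Multiplier inequality for the triple-`∂_Z` forcing terms: for every real `p` there is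
`C = C(p)` so that for all nonzero `k`, all `l, l′`, all `ξ` and `t ≥ 1`,
`|l|³/(k²+l′²+(ξ−kt)²)·⟨t/⟨ξ,l′⟩⟩^p ≤ C|l|(⟨l−l′⟩² + (l²/⟨ξ,l′,t⟩²)·⟨t/⟨ξ,l′⟩⟩^p)`. -/
theorem tripleZ_multiplier_inequality (p : ℝ) :
    ∃ C : ℝ, 0 < C ∧
      ∀ (k : ℤ), k ≠ 0 → ∀ (l l' : ℤ) (ξ : ℝ) (t : ℝ), 1 ≤ t →
        |(l : ℝ)| ^ 3 / ((k : ℝ) ^ 2 + (l' : ℝ) ^ 2 + (ξ - k * t) ^ 2) *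
            jap (t / jap2 ξ (l' : ℝ)) ^ p ≤
          C * |(l : ℝ)| *
            (jap ((l : ℝ) - (l' : ℝ)) ^ 2 +
              (l : ℝ) ^ 2 / jap3 ξ (l' : ℝ) t ^ 2 * jap (t / jap2 ξ (l' : ℝ)) ^ p) := by
  refine ⟨16 + 2 * 3 ^ |p|, by positivity, fun k hk l l' ξ t ht => ?_⟩
  have hκ : 1 ≤ |(k : ℝ)| := by exact_mod_cast Int.one_le_abs hk
  have hκ2 : 1 ≤ (k : ℝ) ^ 2 := (one_le_sq_iff_one_le_abs _).2 hκ
  have hj2 : 0 < jap2 ξ (l' : ℝ) := one_pos.trans_le (one_le_jap2 _ _)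
  set D : ℝ := (k : ℝ) ^ 2 + (l' : ℝ) ^ 2 + (ξ - k * t) ^ 2
  have hDpos : 0 < D := by positivity
  set W : ℝ := jap (t / jap2 ξ (l' : ℝ)) ^ p
  have hWpos : 0 < W := Real.rpow_pos_of_pos (one_pos.trans_le (one_le_jap _)) p
  have hJ : 0 < jap3 ξ (l' : ℝ) t ^ 2 := by rw [jap3_sq]; positivity
  set A : ℝ := jap ((l : ℝ) - (l' : ℝ)) ^ 2
  set B : ℝ := (l : ℝ) ^ 2 / jap3 ξ (l' : ℝ) t ^ 2 * W with hB
  have hA0 : 0 ≤ A := sq_nonneg _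
  have hB0 : 0 ≤ B := by positivity
  have hP : (0 : ℝ) < 3 ^ |p| := by positivity
  have key : (l : ℝ) ^ 2 / D * W ≤ (16 + 2 * 3 ^ |p|) * (A + B) := by
    rcases le_total (2 * jap2 ξ (l' : ℝ)) t with h | h
    · have hle : (l : ℝ) ^ 2 / D ≤ 16 * ((l : ℝ) ^ 2 / jap3 ξ (l' : ℝ) t ^ 2) := by
        rw [← mul_div_assoc, div_le_div_iff₀ hDpos hJ]
        nlinarith [mul_le_mul_of_nonneg_left (jap3_sq_le_of_two_mul_jap2_le hκ ht h)
          (sq_nonneg (l : ℝ))]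
      calc (l : ℝ) ^ 2 / D * W ≤ 16 * ((l : ℝ) ^ 2 / jap3 ξ (l' : ℝ) t ^ 2) * W := by gcongr
        _ = 16 * B := by rw [hB]; ring
        _ ≤ _ := by nlinarith [mul_nonneg hP.le hA0, mul_nonneg hP.le hB0]
    · have hW3 : W ≤ 3 ^ |p| :=
        jap_rpow_le (by positivity) ((div_le_iff₀ hj2).2 h) p
      calc (l : ℝ) ^ 2 / D * W ≤ 2 * A * 3 ^ |p| :=
            mul_le_mul (sq_div_le_jap_sub_sq hκ _) hW3 hWpos.le (by positivity)
        _ ≤ _ := by nlinarith [mul_nonneg hP.le hA0, mul_nonneg hP.le hB0]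
  calc |(l : ℝ)| ^ 3 / D * W = |(l : ℝ)| * ((l : ℝ) ^ 2 / D * W) := by
        rw [← sq_abs (l : ℝ)]; ring
    _ ≤ |(l : ℝ)| * ((16 + 2 * 3 ^ |p|) * (A + B)) := by gcongr
    _ = _ := by ring
end

section
/- For η ∈ ℝ set t_{0,η} := 2|η|, and for an integer j with 1 ≤ j ≤ ⌊√|η|⌋ set t_{j,η} := |η|/j − |η|/(2j(j+1)). For k ∈ ℤ define the critical interval I_{k,η} := [t_{|k|,η}, t_{|k|−1,η}] if ηk > 0 and 1 ≤ |k| ≤ ⌊√|η|⌋, and I_{k,η} := ∅ otherwise. Then for every real K ≥ 1 there exists a constant c = c(K) > 0 such that: whenever η, ξ ∈ ℝ satisfy (1/K)|ξ| ≤ |η| ≤ K|ξ|, and k, n ∈ ℤ and t ∈ ℝ satisfy t ∈ I_{k,η} and t ∈ I_{n,ξ}, at least one of the following holds: (a) k = n; (b) |t − η/k| ≥ |η|/(10K·k²) and |t − ξ/n| ≥ |ξ|/(10K·n²); (c) |η − ξ| ≥ c·|η|/|n|. -/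
/-- The critical times: `t_{0,η} = 2|η|` and, for `1 ≤ j`,
`t_{j,η} = |η|/j − |η|/(2j(j+1))`. -/
noncomputable def tcrit (η : ℝ) (j : ℕ) : ℝ :=
  if j = 0 then 2 * |η| else |η| / (j : ℝ) - |η| / (2 * (j : ℝ) * ((j : ℝ) + 1))

/-- The critical interval `I_{k,η} = [t_{|k|,η}, t_{|k|−1,η}]` when `ηk > 0` and
`1 ≤ |k| ≤ ⌊√|η|⌋`, and `∅` otherwise. -/
noncomputable def Icrit (k : ℤ) (η : ℝ) : Set ℝ :=
  if 0 < η * (k : ℝ) ∧ 1 ≤ k.natAbs ∧ k.natAbs ≤ ⌊Real.sqrt |η|⌋₊ then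
    Set.Icc (tcrit η k.natAbs) (tcrit η (k.natAbs - 1))
  else ∅

theorem le_mul_of_tcrit_le {η t : ℝ} {j : ℕ} (hj : 1 ≤ j) (h : tcrit η j ≤ t) :
    |η| ≤ (j + 1 / 2) * t := by
  have hj' : (1 : ℝ) ≤ j := by exact_mod_cast hj
  have hη := abs_nonneg η
  rw [tcrit, if_neg (by lia)] at h
  have e : |η| / (j : ℝ) - |η| / (2 * (j : ℝ) * ((j : ℝ) + 1))
      = |η| * (2 * j + 1) / (2 * j * (j + 1)) := by
    field_simp
    ring
  rw [e] at h
  have h0 : |η| ≤ (j + 1 / 2) * (|η| * (2 * j + 1) / (2 * j * (j + 1))) := by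
    rw [← mul_div_assoc, le_div_iff₀ (by positivity)]
    nlinarith
  exact h0.trans (by gcongr)

theorem mul_le_of_le_tcrit {η t : ℝ} {j : ℕ} (hj : 1 ≤ j) (h : t ≤ tcrit η j) :
    (j + 1 / 3) * t ≤ |η| := by
  have hj' : (1 : ℝ) ≤ j := by exact_mod_cast hj
  have hη := abs_nonneg η
  rw [tcrit, if_neg (by lia)] at h
  have e : |η| / (j : ℝ) - |η| / (2 * (j : ℝ) * ((j : ℝ) + 1))
      = |η| * (2 * j + 1) / (2 * j * (j + 1)) := by
    field_simp
    ring
  rw [e] at h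
  have h0 : (j + 1 / 3) * (|η| * (2 * j + 1) / (2 * j * (j + 1))) ≤ |η| := by
    rw [← mul_div_assoc, div_le_iff₀ (by positivity)]
    nlinarith [mul_nonneg hη (sub_nonneg.2 hj')]
  exact le_trans (by gcongr) h0

/-- If `t` is close to the centre `|ξ| / n` of a critical interval of `ξ`, then `η` can have `t` in
a critical interval of different index only if it is separated from `ξ`. -/
theorem le_abs_sub_of_near_resonance {η ξ t : ℝ} {k n : ℕ} (hk : 1 ≤ k) (hn : 1 ≤ n)
    (hkn : k ≠ n) (hη : t ∈ Set.Icc (tcrit η k) (tcrit η (k - 1))) (hξ : tcrit ξ n ≤ t)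
    (hnear : |t - |ξ| / n| ≤ |ξ| / (10 * (n : ℝ) ^ 2)) :
    t / 6 ≤ |(|η| - |ξ|)| := by
  have hn' : (1 : ℝ) ≤ n := by exact_mod_cast hn
  have hupper := le_mul_of_tcrit_le hn hξ
  have ht : 0 ≤ t := by
    by_contra! ht
    nlinarith [abs_nonneg ξ]
  have hclose : |(n * t - |ξ|)| ≤ 3 / 20 * t := by
    have e : n * t - |ξ| = n * (t - |ξ| / n) := by
      field_simp
    rw [e, abs_mul, abs_of_nonneg (by positivity : (0 : ℝ) ≤ n)]
    calc (n : ℝ) * |t - |ξ| / n| ≤ n * (|ξ| / (10 * (n : ℝ) ^ 2)) := by gcongr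
      _ = |ξ| / (10 * n) := by field_simp
      _ ≤ 3 / 20 * t := by
        rw [div_le_iff₀ (by positivity)]
        nlinarith
  obtain ⟨h1, h2⟩ := abs_le.1 hclose
  rcases lt_or_gt_of_ne hkn with hlt | hgt
  · have hkn' : (k : ℝ) + 1 ≤ n := by exact_mod_cast hlt
    have ha := le_mul_of_tcrit_le hk hη.1
    rw [abs_sub_comm]
    refine le_trans ?_ (le_abs_self _)
    nlinarith
  · have hkn' : (n : ℝ) ≤ (k - 1 : ℕ) := by exact_mod_cast (by lia : n ≤ k - 1)
    have ha := mul_le_of_le_tcrit (by lia) hη.2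
    refine le_trans ?_ (le_abs_self _)
    nlinarith

theorem mem_Icrit {k : ℤ} {η t : ℝ} (h : t ∈ Icrit k η) :
    0 < η * k ∧ 1 ≤ k.natAbs ∧ t ∈ Set.Icc (tcrit η k.natAbs) (tcrit η (k.natAbs - 1)) := by
  unfold Icrit at h
  split_ifs at h with hc
  · exact ⟨hc.1, hc.2.1, h⟩
  · exact h.elim

theorem div_eq_abs_div_natAbs {k : ℤ} {η : ℝ} (h : 0 < η * k) :
    η / k = |η| / (k.natAbs : ℝ) := by
  rw [Nat.cast_natAbs, Int.cast_abs, ← abs_div, abs_of_pos]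
  rwa [div_pos_iff, ← mul_pos_iff]

theorem near_of_lt {K : ℝ} (hK : 1 ≤ K) {k : ℤ} {η t : ℝ} (hk : 0 < η * k)
    (h : |t - η / k| < |η| / (10 * K * (k : ℝ) ^ 2)) :
    |t - |η| / (k.natAbs : ℝ)| ≤ |η| / (10 * (k.natAbs : ℝ) ^ 2) := by
  have hk0 : (k : ℝ) ≠ 0 := right_ne_zero_of_mul hk.ne'
  rw [← div_eq_abs_div_natAbs hk, Nat.cast_natAbs, Int.cast_abs, sq_abs]
  refine h.le.trans ?_
  gcongr
  linarith

/-- Trichotomy for overlapping critical intervals of comparable frequencies: for every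
`K ≥ 1` there is `c = c(K) > 0` such that whenever `(1/K)|ξ| ≤ |η| ≤ K|ξ|`,
`t ∈ I_{k,η}` and `t ∈ I_{n,ξ}`, either (a) `k = n`, or (b)
`|t − η/k| ≥ |η|/(10Kk²)` and `|t − ξ/n| ≥ |ξ|/(10Kn²)`, or (c) `|η − ξ| ≥ c|η|/|n|`. -/
theorem critical_interval_trichotomy (K : ℝ) (hK : 1 ≤ K) :
    ∃ c : ℝ, 0 < c ∧
      ∀ (η ξ : ℝ) (k n : ℤ) (t : ℝ),
        |ξ| / K ≤ |η| → |η| ≤ K * |ξ| →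
        t ∈ Icrit k η → t ∈ Icrit n ξ →
        (k = n ∨
          (|η| / (10 * K * (k : ℝ) ^ 2) ≤ |t - η / (k : ℝ)| ∧
            |ξ| / (10 * K * (n : ℝ) ^ 2) ≤ |t - ξ / (n : ℝ)|) ∨
          c * |η| / |(n : ℝ)| ≤ |η - ξ|) := by
  refine ⟨1 / (10 * K), by positivity, fun η ξ k n t _ hηξ htk htn => ?_⟩
  obtain ⟨hk, hk1, htk⟩ := mem_Icrit htk
  obtain ⟨hn, hn1, htn⟩ := mem_Icrit htn
  have hn1' : (1 : ℝ) ≤ |(n : ℝ)| := by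
    rw [← Int.cast_abs, ← Nat.cast_natAbs]
    exact_mod_cast hn1
  by_cases hkn : k = n
  · exact Or.inl hkn
  refine Or.inr ?_
  by_cases hnat : k.natAbs = n.natAbs
  · right
    have hneg : k = -n := (Int.natAbs_eq_natAbs_iff.1 hnat).resolve_left hkn
    have hsep : |η| ≤ |η - ξ| := by
      rw [hneg, Int.cast_neg] at hk
      rcases lt_or_gt_of_ne (right_ne_zero_of_mul hn.ne') with h | h
      · have hη : 0 < η := by nlinarith
        have hξ : ξ < 0 := by nlinarith
        rw [abs_of_pos hη]
        exact le_trans (by linarith) (le_abs_self _)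
      · have hη : η < 0 := by nlinarith
        have hξ : 0 < ξ := by nlinarith
        rw [abs_of_neg hη]
        exact le_trans (by linarith) (neg_le_abs _)
    refine le_trans ?_ hsep
    rw [div_le_iff₀ (by positivity)]
    have hc : 1 / (10 * K) ≤ 1 := by
      rw [div_le_one (by positivity)]
      linarith
    nlinarith [abs_nonneg η]
  rw [or_iff_not_imp_left]
  intro hfar
  have hsep : t / 6 ≤ |η - ξ| := by
    refine le_trans ?_ (abs_abs_sub_abs_le η ξ)
    rcases not_and_or.1 hfar with h | h
    · rw [abs_sub_comm]
      exact le_abs_sub_of_near_resonance hn1 hk1 (Ne.symm hnat) htn htk.1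
        (near_of_lt hK hk (not_le.1 h))
    · exact le_abs_sub_of_near_resonance hk1 hn1 hnat htk htn.1 (near_of_lt hK hn (not_le.1 h))
  refine le_trans ?_ hsep
  have hξ := le_mul_of_tcrit_le hn1 htn.1
  rw [Nat.cast_natAbs, Int.cast_abs] at hξ
  have ht : 0 ≤ t := by
    by_contra! ht
    nlinarith [abs_nonneg ξ]
  have hη : |η| ≤ K * (3 / 2 * |(n : ℝ)| * t) :=
    hηξ.trans (by gcongr; nlinarith)
  rw [div_le_iff₀ (by positivity), one_div_mul_eq_div, div_le_iff₀ (by positivity)]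
  nlinarith [mul_nonneg (mul_nonneg (by linarith : 0 ≤ K) (abs_nonneg (n : ℝ))) ht]
end

section
/- Let u = (u¹, u², u³) : ℝ × ℝ³ → ℝ³ and p : ℝ × ℝ³ → ℝ be infinitely differentiable. Denote a spatial point by (x, y, z), write ∂_x, ∂_y, ∂_z for the spatial partial derivatives, Δ := ∂_xx + ∂_yy + ∂_zz for the spatial Laplacian, and ∂_t for the time derivative. Assume that at every point (t,(x,y,z)): ∂_t u¹ + y·∂_x u¹ = −u² − ∂_x p, ∂_t u² + y·∂_x u² = −∂_y p, ∂_t u³ + y·∂_x u³ = −∂_z p, Δp = −2·∂_x u², and ∂_x u¹ + ∂_y u² + ∂_z u³ = 0. Then the function q := Δu² satisfies ∂_t q + y·∂_x q = 0 at every point. -/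
/-- Partial derivative in the time variable of a function of `(t,x,y,z)`. -/
noncomputable def pt (f : ℝ → ℝ → ℝ → ℝ → ℝ) (t x y z : ℝ) : ℝ :=
  deriv (fun s => f s x y z) t

/-- Partial derivative in `x`. -/
noncomputable def px (f : ℝ → ℝ → ℝ → ℝ → ℝ) (t x y z : ℝ) : ℝ :=
  deriv (fun s => f t s y z) x

/-- Partial derivative in `y`. -/
noncomputable def py (f : ℝ → ℝ → ℝ → ℝ → ℝ) (t x y z : ℝ) : ℝ :=
  deriv (fun s => f t x s z) y

/-- Partial derivative in `z`. -/
noncomputable def pz (f : ℝ → ℝ → ℝ → ℝ → ℝ) (t x y z : ℝ) : ℝ :=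
  deriv (fun s => f t x y s) z

/-- The spatial Laplacian `Δ = ∂_xx + ∂_yy + ∂_zz`. -/
noncomputable def lap (f : ℝ → ℝ → ℝ → ℝ → ℝ) (t x y z : ℝ) : ℝ :=
  px (px f) t x y z + py (py f) t x y z + pz (pz f) t x y z

/-- Infinite differentiability of a function of `(t,x,y,z)` jointly in all variables. -/
def Smooth4 (f : ℝ → ℝ → ℝ → ℝ → ℝ) : Prop :=
  ContDiff ℝ (⊤ : ℕ∞) (fun q : ℝ × ℝ × ℝ × ℝ => f q.1 q.2.1 q.2.2.1 q.2.2.2)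

/-- Directional derivative of a function of `(t,x,y,z)`. -/
noncomputable def dirDeriv (v : ℝ × ℝ × ℝ × ℝ) (f : ℝ → ℝ → ℝ → ℝ → ℝ) (t x y z : ℝ) : ℝ :=
  fderiv ℝ (fun q : ℝ × ℝ × ℝ × ℝ => f q.1 q.2.1 q.2.2.1 q.2.2.2) (t, x, y, z) v

namespace Smooth4

variable {f : ℝ → ℝ → ℝ → ℝ → ℝ}

theorem differentiable (hf : Smooth4 f) :
    Differentiable ℝ (fun q : ℝ × ℝ × ℝ × ℝ => f q.1 q.2.1 q.2.2.1 q.2.2.2) :=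
  ContDiff.differentiable hf (by simp)

theorem differentiable_fderiv (hf : Smooth4 f) :
    Differentiable ℝ
      (fderiv ℝ (fun q : ℝ × ℝ × ℝ × ℝ => f q.1 q.2.1 q.2.2.1 q.2.2.2)) :=
  (ContDiff.fderiv_right (m := (⊤ : ℕ∞)) hf (by simp)).differentiable (by simp)

theorem dirDeriv (hf : Smooth4 f) (v : ℝ × ℝ × ℝ × ℝ) : Smooth4 (dirDeriv v f) :=
  (ContDiff.fderiv_right (m := (⊤ : ℕ∞)) hf (by simp)).clm_apply contDiff_const

theorem dirDeriv_comm (hf : Smooth4 f) (v w : ℝ × ℝ × ℝ × ℝ) :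
    _root_.dirDeriv v (_root_.dirDeriv w f) = _root_.dirDeriv w (_root_.dirDeriv v f) := by
  funext t x y z
  have hsymm : IsSymmSndFDerivAt ℝ
      (fun q : ℝ × ℝ × ℝ × ℝ => f q.1 q.2.1 q.2.2.1 q.2.2.2) (t, x, y, z) :=
    (ContDiff.contDiffAt hf).isSymmSndFDerivAt (by
      rw [minSmoothness_of_isRCLikeNormedField]
      exact WithTop.coe_le_coe.2 (le_top : (2 : ℕ∞) ≤ ⊤))
  have key (a b : ℝ × ℝ × ℝ × ℝ) : _root_.dirDeriv a (_root_.dirDeriv b f) t x y z =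
      fderiv ℝ (fderiv ℝ (fun q : ℝ × ℝ × ℝ × ℝ => f q.1 q.2.1 q.2.2.1 q.2.2.2))
        (t, x, y, z) a b := by
    change fderiv ℝ (fun q => fderiv ℝ
      (fun q : ℝ × ℝ × ℝ × ℝ => f q.1 q.2.1 q.2.2.1 q.2.2.2) q b) (t, x, y, z) a = _
    rw [fderiv_clm_apply (hf.differentiable_fderiv _) (differentiableAt_const b)]
    simp
  rw [key, key, hsymm.eq]

theorem hasDerivAt_dirDeriv (hf : Smooth4 f) {c : ℝ → ℝ × ℝ × ℝ × ℝ} {v : ℝ × ℝ × ℝ × ℝ}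
    {s : ℝ} (hc : HasDerivAt c v s) :
    HasDerivAt (fun r => f (c r).1 (c r).2.1 (c r).2.2.1 (c r).2.2.2)
      (_root_.dirDeriv v f (c s).1 (c s).2.1 (c s).2.2.1 (c s).2.2.2) s :=
  (hf.differentiable (c s)).hasFDerivAt.comp_hasDerivAt s hc

theorem pt_eq (hf : Smooth4 f) : pt f = _root_.dirDeriv (1, 0, 0, 0) f := by
  funext t x y z
  exact (hf.hasDerivAt_dirDeriv (c := fun s => (s, x, y, z)) (s := t)
    ((hasDerivAt_id _).prodMk
      ((hasDerivAt_const _ _).prodMk ((hasDerivAt_const _ _).prodMk (hasDerivAt_const _ _))))).deriv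

theorem pt (hf : Smooth4 f) : Smooth4 (pt f) :=
  hf.pt_eq ▸ hf.dirDeriv _

theorem hasDerivAt_pt (hf : Smooth4 f) (t x y z : ℝ) :
    HasDerivAt (fun s => f s x y z) (_root_.pt f t x y z) t := by
  rw [hf.pt_eq]
  exact hf.hasDerivAt_dirDeriv (c := fun s => (s, x, y, z)) (s := t)
    ((hasDerivAt_id _).prodMk
      ((hasDerivAt_const _ _).prodMk ((hasDerivAt_const _ _).prodMk (hasDerivAt_const _ _))))

theorem px_eq (hf : Smooth4 f) : px f = _root_.dirDeriv (0, 1, 0, 0) f := by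
  funext t x y z
  exact (hf.hasDerivAt_dirDeriv (c := fun s => (t, s, y, z)) (s := x)
    ((hasDerivAt_const _ _).prodMk
      ((hasDerivAt_id _).prodMk ((hasDerivAt_const _ _).prodMk (hasDerivAt_const _ _))))).deriv

theorem px (hf : Smooth4 f) : Smooth4 (px f) :=
  hf.px_eq ▸ hf.dirDeriv _

theorem hasDerivAt_px (hf : Smooth4 f) (t x y z : ℝ) :
    HasDerivAt (fun s => f t s y z) (_root_.px f t x y z) x := by
  rw [hf.px_eq]
  exact hf.hasDerivAt_dirDeriv (c := fun s => (t, s, y, z)) (s := x)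
    ((hasDerivAt_const _ _).prodMk
      ((hasDerivAt_id _).prodMk ((hasDerivAt_const _ _).prodMk (hasDerivAt_const _ _))))

theorem py_eq (hf : Smooth4 f) : py f = _root_.dirDeriv (0, 0, 1, 0) f := by
  funext t x y z
  exact (hf.hasDerivAt_dirDeriv (c := fun s => (t, x, s, z)) (s := y)
    ((hasDerivAt_const _ _).prodMk
      ((hasDerivAt_const _ _).prodMk ((hasDerivAt_id _).prodMk (hasDerivAt_const _ _))))).deriv

theorem py (hf : Smooth4 f) : Smooth4 (py f) :=
  hf.py_eq ▸ hf.dirDeriv _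

theorem hasDerivAt_py (hf : Smooth4 f) (t x y z : ℝ) :
    HasDerivAt (fun s => f t x s z) (_root_.py f t x y z) y := by
  rw [hf.py_eq]
  exact hf.hasDerivAt_dirDeriv (c := fun s => (t, x, s, z)) (s := y)
    ((hasDerivAt_const _ _).prodMk
      ((hasDerivAt_const _ _).prodMk ((hasDerivAt_id _).prodMk (hasDerivAt_const _ _))))

theorem pz_eq (hf : Smooth4 f) : pz f = _root_.dirDeriv (0, 0, 0, 1) f := by
  funext t x y z
  exact (hf.hasDerivAt_dirDeriv (c := fun s => (t, x, y, s)) (s := z)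
    ((hasDerivAt_const _ _).prodMk
      ((hasDerivAt_const _ _).prodMk ((hasDerivAt_const _ _).prodMk (hasDerivAt_id _))))).deriv

theorem pz (hf : Smooth4 f) : Smooth4 (pz f) :=
  hf.pz_eq ▸ hf.dirDeriv _

theorem hasDerivAt_pz (hf : Smooth4 f) (t x y z : ℝ) :
    HasDerivAt (fun s => f t x y s) (_root_.pz f t x y z) z := by
  rw [hf.pz_eq]
  exact hf.hasDerivAt_dirDeriv (c := fun s => (t, x, y, s)) (s := z)
    ((hasDerivAt_const _ _).prodMk
      ((hasDerivAt_const _ _).prodMk ((hasDerivAt_const _ _).prodMk (hasDerivAt_id _))))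

theorem pt_px (hf : Smooth4 f) : _root_.pt (_root_.px f) = _root_.px (_root_.pt f) := by
  rw [hf.px.pt_eq, hf.px_eq, hf.pt.px_eq, hf.pt_eq, hf.dirDeriv_comm]

theorem pt_py (hf : Smooth4 f) : _root_.pt (_root_.py f) = _root_.py (_root_.pt f) := by
  rw [hf.py.pt_eq, hf.py_eq, hf.pt.py_eq, hf.pt_eq, hf.dirDeriv_comm]

theorem pt_pz (hf : Smooth4 f) : _root_.pt (_root_.pz f) = _root_.pz (_root_.pt f) := by
  rw [hf.pz.pt_eq, hf.pz_eq, hf.pt.pz_eq, hf.pt_eq, hf.dirDeriv_comm]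

theorem py_px (hf : Smooth4 f) : _root_.py (_root_.px f) = _root_.px (_root_.py f) := by
  rw [hf.px.py_eq, hf.px_eq, hf.py.px_eq, hf.py_eq, hf.dirDeriv_comm]

theorem pz_px (hf : Smooth4 f) : _root_.pz (_root_.px f) = _root_.px (_root_.pz f) := by
  rw [hf.px.pz_eq, hf.px_eq, hf.pz.px_eq, hf.pz_eq, hf.dirDeriv_comm]

theorem py_pz (hf : Smooth4 f) : _root_.py (_root_.pz f) = _root_.pz (_root_.py f) := by
  rw [hf.pz.py_eq, hf.pz_eq, hf.py.pz_eq, hf.py_eq, hf.dirDeriv_comm]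

end Smooth4

/-- For the linearized 3D Euler equations around Couette flow, the quantity `q = Δu²`
is exactly transported: `∂_t q + y ∂_x q = 0`. -/
theorem linearized_euler_q2_transported (u1 u2 u3 p : ℝ → ℝ → ℝ → ℝ → ℝ)
    (hu1 : Smooth4 u1) (hu2 : Smooth4 u2) (hu3 : Smooth4 u3) (hp : Smooth4 p)
    (heq1 : ∀ t x y z, pt u1 t x y z + y * px u1 t x y z = -u2 t x y z - px p t x y z)
    (heq2 : ∀ t x y z, pt u2 t x y z + y * px u2 t x y z = -py p t x y z)
    (heq3 : ∀ t x y z, pt u3 t x y z + y * px u3 t x y z = -pz p t x y z)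
    (hpress : ∀ t x y z, lap p t x y z = -2 * px u2 t x y z)
    (hdiv : ∀ t x y z, px u1 t x y z + py u2 t x y z + pz u3 t x y z = 0) :
    ∀ t x y z, pt (lap u2) t x y z + y * px (lap u2) t x y z = 0 := by
  have hpy : py p = fun t x y z => -pt u2 t x y z - y * px u2 t x y z := by
    funext t x y z
    linarith [heq2 t x y z]
  have hlap : lap p = fun t x y z => -2 * px u2 t x y z := by
    funext t x y z
    exact hpress t x y z
  have hxx : px (px (py p)) =
      fun t x y z => -px (px (pt u2)) t x y z - y * px (px (px u2)) t x y z := by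
    have h : px (py p) = fun t x y z => -px (pt u2) t x y z - y * px (px u2) t x y z := by
      rw [hpy]
      funext t x y z
      exact ((hu2.pt.hasDerivAt_px t x y z).neg.sub
        ((hu2.px.hasDerivAt_px t x y z).const_mul y)).deriv
    rw [h]
    funext t x y z
    exact ((hu2.pt.px.hasDerivAt_px t x y z).neg.sub
      ((hu2.px.px.hasDerivAt_px t x y z).const_mul y)).deriv
  have hzz : pz (pz (py p)) =
      fun t x y z => -pz (pz (pt u2)) t x y z - y * pz (pz (px u2)) t x y z := by
    have h : pz (py p) = fun t x y z => -pz (pt u2) t x y z - y * pz (px u2) t x y z := by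
      rw [hpy]
      funext t x y z
      exact ((hu2.pt.hasDerivAt_pz t x y z).neg.sub
        ((hu2.px.hasDerivAt_pz t x y z).const_mul y)).deriv
    rw [h]
    funext t x y z
    exact ((hu2.pt.pz.hasDerivAt_pz t x y z).neg.sub
      ((hu2.px.pz.hasDerivAt_pz t x y z).const_mul y)).deriv
  have hyy : py (py (py p)) = fun t x y z =>
      -py (py (pt u2)) t x y z - 2 * py (px u2) t x y z - y * py (py (px u2)) t x y z := by
    have h : py (py p) = fun t x y z =>
        -py (pt u2) t x y z - (px u2 t x y z + y * py (px u2) t x y z) := by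
      rw [hpy]
      funext t x y z
      refine (((hu2.pt.hasDerivAt_py t x y z).neg.sub
        ((hasDerivAt_id y).mul (hu2.px.hasDerivAt_py t x y z))).deriv).trans ?_
      simp
    rw [h]
    funext t x y z
    refine (((hu2.pt.py.hasDerivAt_py t x y z).neg.sub
      ((hu2.px.hasDerivAt_py t x y z).add
        ((hasDerivAt_id y).mul (hu2.px.py.hasDerivAt_py t x y z)))).deriv).trans ?_
    simp only [id]
    ring
  intro t x y z
  have h1 : py (lap p) t x y z = -2 * py (px u2) t x y z := by
    rw [hlap]
    exact ((hu2.px.hasDerivAt_py t x y z).const_mul (-2)).deriv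
  have h2 : py (lap p) t x y z =
      py (px (px p)) t x y z + py (py (py p)) t x y z + py (pz (pz p)) t x y z :=
    (((hp.px.px.hasDerivAt_py t x y z).add (hp.py.py.hasDerivAt_py t x y z)).add
      (hp.pz.pz.hasDerivAt_py t x y z)).deriv
  have h3 : pt (lap u2) t x y z =
      pt (px (px u2)) t x y z + pt (py (py u2)) t x y z + pt (pz (pz u2)) t x y z :=
    (((hu2.px.px.hasDerivAt_pt t x y z).add (hu2.py.py.hasDerivAt_pt t x y z)).add
      (hu2.pz.pz.hasDerivAt_pt t x y z)).deriv
  have h4 : px (lap u2) t x y z =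
      px (px (px u2)) t x y z + px (py (py u2)) t x y z + px (pz (pz u2)) t x y z :=
    (((hu2.px.px.hasDerivAt_px t x y z).add (hu2.py.py.hasDerivAt_px t x y z)).add
      (hu2.pz.pz.hasDerivAt_px t x y z)).deriv
  rw [hp.px.py_px, hp.py_px, hp.pz.py_pz, hp.py_pz, hxx, hyy, hzz, h1] at h2
  rw [hu2.px.pt_px, hu2.pt_px, hu2.py.pt_py, hu2.pt_py, hu2.pz.pt_pz, hu2.pt_pz] at h3
  rw [← hu2.py.py_px, ← hu2.py_px, ← hu2.pz.pz_px, ← hu2.pz_px] at h4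
  rw [h3, h4]
  linarith
end
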